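/- Let G₁, G₂, G₃, G₄ be simple connected undirected graphs, each on m vertices, with Laplacians L₁, …, L₄, let L₀ = diag(L₁, L₂, L₃, L₄) and L = L₀ + L_*, and assume a(G_k) ≥ λ₋ − μ₋ for k = 1, 2, 3, 4. Then the second-smallest eigenvalue of L equals λ₋ = m + 1 − √(m² + 1), with corresponding eigenvector φ₋ = (1, 1−λ₋, λ₋−1, −1)ᵀ⊗𝟙; that is, L φ₋ = λ₋ φ₋ and ⟨L v, v⟩ ≥ λ₋ ⟨v, v⟩ for every v ∈ ℝ^{4m} with ⟨v, 𝟙_{4m}⟩ = 0. -/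

import Mathlib

open Matrix Polynomial

/-- `lamMinus m` is the eigenvalue `m + 1 - sqrt (m^2 + 1)`. -/
noncomputable def lamMinus (m : ℕ) : ℝ := m + 1 - Real.sqrt ((m : ℝ) ^ 2 + 1)

/-- `muMinus m` is the eigenvalue `m/2 + 1 - sqrt (m^2/4 + 1)`. -/
noncomputable def muMinus (m : ℕ) : ℝ := (m : ℝ) / 2 + 1 - Real.sqrt ((m : ℝ) ^ 2 / 4 + 1)

/-- The matrix `L_*` on `ℝ^{4m}`, indexed by pairs `(b, p)` where `b : Fin 4` is the block
index and `p : Fin m` is the position within the block.  In 4×4 block form with m×m blocks,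
`L_* = [[I, -I, 0, 0], [-I, (m+1)I, -J, 0], [0, -J, (m+1)I, -I], [0, 0, -I, I]]`,
where `J` is the all-ones matrix. -/
def Lstar (m : ℕ) : Matrix (Fin 4 × Fin m) (Fin 4 × Fin m) ℝ := fun i j =>
  if i.1 = j.1 then
    (if i.1.val = 0 ∨ i.1.val = 3 then (if i.2 = j.2 then 1 else 0)
     else ((m : ℝ) + 1) * (if i.2 = j.2 then 1 else 0))
  else if (i.1.val = 0 ∧ j.1.val = 1) ∨ (i.1.val = 1 ∧ j.1.val = 0) ∨
          (i.1.val = 2 ∧ j.1.val = 3) ∨ (i.1.val = 3 ∧ j.1.val = 2) then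
    (if i.2 = j.2 then -1 else 0)
  else if (i.1.val = 1 ∧ j.1.val = 2) ∨ (i.1.val = 2 ∧ j.1.val = 1) then -1
  else 0

/-- `tensor c ξ` is the vector `(c 0, c 1, c 2, c 3)ᵀ ⊗ ξ` in `ℝ^{4m}`:
its four consecutive blocks of length `m` are `c 0 • ξ`, `c 1 • ξ`, `c 2 • ξ`, `c 3 • ξ`. -/
def tensor {m : ℕ} (c : Fin 4 → ℝ) (ξ : Fin m → ℝ) : Fin 4 × Fin m → ℝ := fun i => c i.1 * ξ i.2

/-- The block-diagonal matrix `diag(Ls 0, Ls 1, Ls 2, Ls 3)` on `ℝ^{4m}`. -/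
def blockDiag4 {m : ℕ} (Ls : Fin 4 → Matrix (Fin m) (Fin m) ℝ) :
    Matrix (Fin 4 × Fin m) (Fin 4 × Fin m) ℝ := fun i j =>
  if i.1 = j.1 then Ls i.1 i.2 j.2 else 0

/-- The second-smallest eigenvalue (counted with multiplicity) of a matrix, obtained as the
second entry of the nondecreasing rearrangement of the roots of its characteristic polynomial. -/
noncomputable def secondEig {N : Type*} [Fintype N] [DecidableEq N]
    (M : Matrix N N ℝ) : ℝ :=
  (M.charpoly.roots.sort (· ≤ ·)).getD 1 0

/-- The algebraic connectivity `a(G)`: the second-smallest eigenvalue of the graph Laplacian. -/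
noncomputable def algConn {N : Type*} [Fintype N] [DecidableEq N]
    (G : SimpleGraph N) [DecidableRel G.Adj] : ℝ :=
  secondEig (SimpleGraph.lapMatrix ℝ G)

/-- Spectral data of a real symmetric matrix in coordinates. -/
lemma spectral_data {N : Type*} [Fintype N] [DecidableEq N] (M : Matrix N N ℝ)
    (hM : M.IsHermitian) : ∃ (e : N → N → ℝ) (f : N → ℝ),
      (∀ i, M *ᵥ e i = f i • e i) ∧ (∀ i j, e i ⬝ᵥ e j = if i = j then 1 else 0) ∧
      (∀ x y : N → ℝ, x ⬝ᵥ y = ∑ i, (e i ⬝ᵥ x) * (e i ⬝ᵥ y)) ∧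
      M.charpoly.roots = Multiset.map f Finset.univ.val := by
  refine ⟨fun i => ⇑(hM.eigenvectorBasis i), hM.eigenvalues, hM.mulVec_eigenvectorBasis, ?_, ?_, ?_⟩
  · intro i j
    have h := hM.eigenvectorBasis.inner_eq_ite i j
    rw [← h, dotProduct_comm]
    simp [PiLp.inner_apply, dotProduct]
  · intro x y
    have h := hM.eigenvectorBasis.sum_inner_mul_inner (WithLp.toLp 2 x) (WithLp.toLp 2 y)
    have h1 : inner ℝ (WithLp.toLp 2 x) (WithLp.toLp 2 y) = x ⬝ᵥ y := by
      rw [dotProduct_comm]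
      simp [PiLp.inner_apply, dotProduct]
    rw [← h1, ← h]
    refine Finset.sum_congr rfl fun i _ => ?_
    congr 1
    simp [PiLp.inner_apply, dotProduct, mul_comm]
  · rw [hM.roots_charpoly_eq_eigenvalues]
    rfl

lemma dot_symm {N : Type*} [Fintype N] (M : Matrix N N ℝ)
    (hM : M.IsHermitian) (x y : N → ℝ) : x ⬝ᵥ (M *ᵥ y) = (M *ᵥ x) ⬝ᵥ y := by
  rw [dotProduct_mulVec, ← mulVec_transpose]
  have : Mᵀ = M := by simpa [IsHermitian, conjTranspose_eq_transpose_of_trivial] using hM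
  rw [this]

lemma sort_map_univ {N : Type*} [Fintype N] [DecidableEq N] (f : N → ℝ) (i0 : N)
    (h0 : ∀ i, f i0 ≤ f i) :
    (Multiset.map f Finset.univ.val).sort (· ≤ ·)
      = f i0 :: (Multiset.map f (Finset.univ.erase i0).val).sort (· ≤ ·) := by
  rw [← Multiset.sort_cons, ← Multiset.map_cons]
  · congr 2
    rw [Finset.erase_val, Multiset.cons_erase]
    simp
  · intro b hb
    obtain ⟨i, -, rfl⟩ := Multiset.mem_map.1 hb
    exact h0 i

lemma getD_le {l : List ℝ} (hl : l.Pairwise (· ≤ ·)) {x : ℝ} (hx : x ∈ l) : l.getD 0 0 ≤ x := by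
  cases l with
  | nil => simp at hx
  | cons a t =>
    rcases List.mem_cons.1 hx with rfl | h
    · simp
    · simpa using (List.pairwise_cons.1 hl).1 x h

lemma getD_mem {l : List ℝ} {x : ℝ} (hx : x ∈ l) : l.getD 0 0 ∈ l := by
  cases l with
  | nil => simp at hx
  | cons a t => simp

lemma secondEig_le {N : Type*} [Fintype N] [DecidableEq N] [Nonempty N] (M : Matrix N N ℝ)
    (f : N → ℝ) (hf : M.charpoly.roots = Multiset.map f Finset.univ.val) :
    ∃ i0, ∀ i, i ≠ i0 → secondEig M ≤ f i := by
  obtain ⟨i0, h0⟩ := Finite.exists_min f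
  refine ⟨i0, fun i hi => ?_⟩
  rw [secondEig, hf, sort_map_univ f i0 h0, List.getD_cons_succ]
  refine getD_le (Multiset.pairwise_sort _ _) ?_
  rw [Multiset.mem_sort]
  exact Multiset.mem_map.2 ⟨i, Finset.mem_erase.2 ⟨hi, Finset.mem_univ _⟩, rfl⟩

lemma secondEig_eq {N : Type*} [Fintype N] [DecidableEq N] (M : Matrix N N ℝ)
    (f : N → ℝ) (hf : M.charpoly.roots = Multiset.map f Finset.univ.val) (i0 i1 : N)
    (h01 : i1 ≠ i0) (h0 : f i0 ≤ f i1) (h1 : ∀ i, i ≠ i0 → f i1 ≤ f i) :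
    secondEig M = f i1 := by
  have h0' : ∀ i, f i0 ≤ f i := by
    intro i
    by_cases h : i = i0
    · rw [h]
    · exact h0.trans (h1 i h)
  rw [secondEig, hf, sort_map_univ f i0 h0', List.getD_cons_succ]
  have hmem : f i1 ∈ (Multiset.map f (Finset.univ.erase i0).val).sort (· ≤ ·) := by
    rw [Multiset.mem_sort]
    exact Multiset.mem_map.2 ⟨i1, Finset.mem_erase.2 ⟨h01, Finset.mem_univ _⟩, rfl⟩
  apply le_antisymm
  · exact getD_le (Multiset.pairwise_sort _ _) hmem
  · have := getD_mem hmem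
    rw [Multiset.mem_sort] at this
    obtain ⟨i, hi, h⟩ := Multiset.mem_map.1 this
    rw [← h]
    exact h1 i (Finset.mem_erase.1 hi).1

lemma form_lower {N : Type*} [Fintype N] [DecidableEq N] [Nonempty N] (M : Matrix N N ℝ)
    (hM : M.IsHermitian) (u : N → ℝ) (hu : M *ᵥ u = 0) (hu0 : u ⬝ᵥ u ≠ 0) (s : ℝ) (hs : 0 < s)
    (hs2 : s ≤ secondEig M) (v : N → ℝ) (hv : u ⬝ᵥ v = 0) :
    s * (v ⬝ᵥ v) ≤ (M *ᵥ v) ⬝ᵥ v := by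
  obtain ⟨e, f, h1, -, h3, h4⟩ := spectral_data M hM
  obtain ⟨i0, h0⟩ := secondEig_le M f h4
  have key : ∀ i x, e i ⬝ᵥ (M *ᵥ x) = f i * (e i ⬝ᵥ x) := by
    intro i x
    rw [dot_symm M hM, h1, smul_dotProduct, smul_eq_mul]
  have hz : ∀ i, i ≠ i0 → e i ⬝ᵥ u = 0 := by
    intro i hi
    have := key i u
    rw [hu, dotProduct_zero] at this
    have hp : f i ≠ 0 := (by linarith [h0 i hi] : 0 < f i).ne'
    rcases mul_eq_zero.1 this.symm with h | h
    · exact absurd h hp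
    · exact h
  have e1 : ∀ x, u ⬝ᵥ x = (e i0 ⬝ᵥ u) * (e i0 ⬝ᵥ x) := by
    intro x
    rw [h3 u x]
    apply Finset.sum_eq_single i0
    · intro i _ hi
      rw [hz i hi, zero_mul]
    · simp
  have hv0 : e i0 ⬝ᵥ v = 0 := by
    rw [e1] at hv hu0
    rcases mul_eq_zero.1 hv with h | h
    · rw [h] at hu0
      simp at hu0
    · exact h
  rw [h3 v v, h3 (M *ᵥ v) v, Finset.mul_sum]
  refine Finset.sum_le_sum fun i _ => ?_
  rw [key]
  by_cases hi : i = i0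
  · rw [hi, hv0]
    simp
  · have := hs2.trans (h0 i hi)
    nlinarith [mul_self_nonneg (e i ⬝ᵥ v)]

lemma exists_eig {N : Type*} [Fintype N] (M : Matrix N N ℝ)
    (hM : M.IsHermitian) (e : N → N → ℝ) (f : N → ℝ) (h1 : ∀ i, M *ᵥ e i = f i • e i)
    (h3 : ∀ x y : N → ℝ, x ⬝ᵥ y = ∑ i, (e i ⬝ᵥ x) * (e i ⬝ᵥ y))
    (u : N → ℝ) (c : ℝ) (hu : M *ᵥ u = c • u) (hu0 : u ⬝ᵥ u ≠ 0) : ∃ i, f i = c := by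
  by_contra hcon
  push Not at hcon
  apply hu0
  rw [h3]
  refine Finset.sum_eq_zero fun i _ => ?_
  have : e i ⬝ᵥ (M *ᵥ u) = f i * (e i ⬝ᵥ u) := by
    rw [dot_symm M hM, h1, smul_dotProduct, smul_eq_mul]
  rw [hu, dotProduct_smul, smul_eq_mul] at this
  have h : (f i - c) * (e i ⬝ᵥ u) = 0 := by linarith
  rcases mul_eq_zero.1 h with h | h
  · exact absurd (by linarith) (hcon i)
  · rw [h, zero_mul]

lemma secondEig_of_form {N : Type*} [Fintype N] [DecidableEq N] (M : Matrix N N ℝ)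
    (hM : M.IsHermitian) (u w : N → ℝ) (l : ℝ) (hl : 0 < l)
    (hu : M *ᵥ u = 0) (hu0 : u ⬝ᵥ u ≠ 0) (hw : M *ᵥ w = l • w) (hw0 : w ⬝ᵥ w ≠ 0)
    (hform : ∀ v, u ⬝ᵥ v = 0 → l * (v ⬝ᵥ v) ≤ (M *ᵥ v) ⬝ᵥ v) : secondEig M = l := by
  obtain ⟨e, f, h1, h2, h3, h4⟩ := spectral_data M hM
  obtain ⟨i0, hi0⟩ := exists_eig M hM e f h1 h3 u 0 (by simpa using hu) hu0
  obtain ⟨i1, hi1⟩ := exists_eig M hM e f h1 h3 w l hw hw0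
  have hne : i1 ≠ i0 := by
    rintro rfl
    linarith
  have hone : ∀ i, e i ⬝ᵥ u = 0 → l ≤ f i := by
    intro i hi
    have := hform (e i) (by rw [dotProduct_comm]; exact hi)
    rw [h1, smul_dotProduct, h2] at this
    simpa using this
  have := secondEig_eq M f h4 i0 i1 hne (by linarith) ?_
  · rw [this, hi1]
  intro i hi
  rw [hi1]
  by_contra hlt
  push Not at hlt
  have hb : e i0 ⬝ᵥ u ≠ 0 := by
    intro h
    linarith [hone i0 h]
  have hii : ¬ (i0 = i) := fun h => hi h.symm
  have hv := hform ((e i0 ⬝ᵥ u) • e i - (e i ⬝ᵥ u) • e i0) (by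
    rw [dotProduct_sub, dotProduct_smul, dotProduct_smul, dotProduct_comm u, dotProduct_comm u]
    simp only [smul_eq_mul]
    ring)
  simp only [mulVec_sub, mulVec_smul, h1, dotProduct_sub, sub_dotProduct, dotProduct_smul,
    smul_dotProduct, h2, smul_eq_mul, hi, hii, if_true, if_false, hi0] at hv
  have hb2 : 0 < (e i0 ⬝ᵥ u) ^ 2 := by positivity
  nlinarith [sq_nonneg (e i ⬝ᵥ u), mul_pos hb2 (sub_pos.2 hlt)]

lemma blockDiag4_mulVec {m : ℕ} (Ls : Fin 4 → Matrix (Fin m) (Fin m) ℝ) (v : Fin 4 × Fin m → ℝ)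
    (k : Fin 4) (p : Fin m) :
    (blockDiag4 Ls *ᵥ v) (k, p) = (Ls k *ᵥ fun q => v (k, q)) p := by
  simp [mulVec, dotProduct, blockDiag4, Fintype.sum_prod_type, ite_mul]

lemma Lstar_mulVec0 {m : ℕ} (v : Fin 4 × Fin m → ℝ) (p : Fin m) :
    (Lstar m *ᵥ v) (0, p) = v (0, p) - v (1, p) := by
  simp [mulVec, dotProduct, Lstar, Fintype.sum_prod_type, Fin.sum_univ_four, ite_mul]
  ring

lemma Lstar_mulVec1 {m : ℕ} (v : Fin 4 × Fin m → ℝ) (p : Fin m) :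
    (Lstar m *ᵥ v) (1, p) = - v (0, p) + (m + 1) * v (1, p) - ∑ q, v (2, q) := by
  simp [mulVec, dotProduct, Lstar, Fintype.sum_prod_type, Fin.sum_univ_four, ite_mul]
  ring

lemma Lstar_mulVec2 {m : ℕ} (v : Fin 4 × Fin m → ℝ) (p : Fin m) :
    (Lstar m *ᵥ v) (2, p) = - v (3, p) + (m + 1) * v (2, p) - ∑ q, v (1, q) := by
  simp [mulVec, dotProduct, Lstar, Fintype.sum_prod_type, Fin.sum_univ_four, ite_mul]
  ring

lemma Lstar_mulVec3 {m : ℕ} (v : Fin 4 × Fin m → ℝ) (p : Fin m) :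
    (Lstar m *ᵥ v) (3, p) = v (3, p) - v (2, p) := by
  simp [mulVec, dotProduct, Lstar, Fintype.sum_prod_type, Fin.sum_univ_four, ite_mul]
  ring

lemma Lstar_symm (m : ℕ) : (Lstar m).IsHermitian := by
  ext ⟨i, p⟩ ⟨j, q⟩
  simp only [conjTranspose_apply, star_trivial, Lstar]
  fin_cases i <;> fin_cases j <;> simp [eq_comm]

lemma blockDiag4_symm {m : ℕ} (Ls : Fin 4 → Matrix (Fin m) (Fin m) ℝ)
    (h : ∀ k, (Ls k).IsHermitian) : (blockDiag4 Ls).IsHermitian := by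
  ext ⟨i, p⟩ ⟨j, q⟩
  simp only [conjTranspose_apply, star_trivial, blockDiag4]
  by_cases hij : i = j
  · subst hij
    simpa using (h i).apply p q
  · rw [if_neg hij, if_neg (Ne.symm hij)]

/-- Graph Laplacian lower bound, without centering. -/
lemma lap_lower {m : ℕ} (hm : 1 ≤ m) (G : SimpleGraph (Fin m)) [DecidableRel G.Adj] (s : ℝ)
    (hs : 0 < s) (h : s ≤ algConn G) (x : Fin m → ℝ) :
    s * ((∑ p, x p * x p) - (∑ p, x p) ^ 2 / m)
      ≤ ∑ p, (SimpleGraph.lapMatrix ℝ G *ᵥ x) p * x p := by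
  have : Nonempty (Fin m) := ⟨⟨0, hm⟩⟩
  have hm0 : (m : ℝ) ≠ 0 := by positivity
  have hH := SimpleGraph.isHermitian_lapMatrix ℝ G
  have h1 := SimpleGraph.lapMatrix_mulVec_const_eq_zero (R := ℝ) G
  have hx : x = (x - ((∑ p, x p) / m) • (fun _ => (1 : ℝ))) +
      ((∑ p, x p) / m) • (fun _ => (1 : ℝ)) := by simp
  set t := (∑ p, x p) / m with ht
  have hS : ∑ p, x p = m * t := by rw [ht]; field_simp
  have key := form_lower _ hH (fun _ => 1) h1 (by simp [dotProduct, hm0]) s hs h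
    (x - t • (fun _ => (1 : ℝ))) (by
      simp [dotProduct, Finset.sum_sub_distrib]
      rw [hS]; ring)
  rw [mulVec_sub, mulVec_smul, h1, smul_zero, sub_zero] at key
  have e1 : (SimpleGraph.lapMatrix ℝ G *ᵥ x) ⬝ᵥ (x - t • (fun _ => (1 : ℝ)))
      = ∑ p, (SimpleGraph.lapMatrix ℝ G *ᵥ x) p * x p := by
    rw [dotProduct_sub, dotProduct_smul, ← dot_symm _ hH x (fun _ => 1), h1]
    simp [dotProduct]
  have e2 : (x - t • (fun _ => (1 : ℝ))) ⬝ᵥ (x - t • (fun _ => (1 : ℝ)))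
      = (∑ p, x p * x p) - (∑ p, x p) ^ 2 / m := by
    have : ∀ p, (x p - t) * (x p - t) = x p * x p - 2 * t * x p + t ^ 2 := fun p => by ring
    simp only [dotProduct, Pi.sub_apply, Pi.smul_apply, smul_eq_mul, mul_one, this,
      Finset.sum_add_distrib, Finset.sum_sub_distrib, ← Finset.mul_sum]
    simp only [hS, Finset.sum_const, Finset.card_univ, Fintype.card_fin, nsmul_eq_mul]
    field_simp
    ring
  rw [e1, e2] at key
  exact key

/-- Two-block bound on deviations from the mean. -/
lemma pair_lower {m : ℕ} (hm : 1 ≤ m) (μ : ℝ) (h1 : 0 < 1 - μ)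
    (h2 : (1 - μ) * (m + 1 - μ) = 1) (x y : Fin m → ℝ) :
    0 ≤ (1 - μ) * ((∑ p, x p * x p) - (∑ p, x p) ^ 2 / m)
      - 2 * ((∑ p, x p * y p) - (∑ p, x p) * (∑ p, y p) / m)
      + (m + 1 - μ) * ((∑ p, y p * y p) - (∑ p, y p) ^ 2 / m) := by
  have hm0 : (m : ℝ) ≠ 0 := by positivity
  set t := (∑ p, x p) / m with ht
  set r := (∑ p, y p) / m with hr
  have hS : ∑ p, x p = m * t := by rw [ht]; field_simp
  have hR : ∑ p, y p = m * r := by rw [hr]; field_simp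
  have hnn : 0 ≤ ∑ p, ((1 - μ) * (x p - t) - (y p - r)) ^ 2 :=
    Finset.sum_nonneg fun p _ => sq_nonneg _
  have hexp : ∀ p, ((1 - μ) * (x p - t) - (y p - r)) ^ 2
      = (1 - μ) ^ 2 * (x p * x p) - 2 * (1 - μ) * (x p * y p) + y p * y p
        + (-2 * (1 - μ) ^ 2 * t + 2 * (1 - μ) * r) * x p
        + (2 * (1 - μ) * t - 2 * r) * y p + ((1 - μ) * t - r) ^ 2 := fun p => by ring
  simp only [hexp, Finset.sum_add_distrib, Finset.sum_sub_distrib, ← Finset.mul_sum] at hnn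
  simp only [hS, hR, Finset.sum_const, Finset.card_univ, Fintype.card_fin, nsmul_eq_mul] at hnn ⊢
  generalize (∑ p, x p * x p) = X at *
  generalize (∑ p, y p * y p) = Y at *
  generalize (∑ p, x p * y p) = Z at *
  have a1 : ((m : ℝ) * t) ^ 2 / m = m * t ^ 2 := by field_simp
  have a2 : ((m : ℝ) * r) ^ 2 / m = m * r ^ 2 := by field_simp
  have a3 : ((m : ℝ) * t) * (m * r) / m = m * (t * r) := by field_simp
  rw [a1, a2, a3]
  refine nonneg_of_mul_nonneg_right (a := 1 - μ) ?_ h1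
  have : (1 - μ) * ((1 - μ) * (X - m * t ^ 2) - 2 * (Z - m * (t * r))
      + (m + 1 - μ) * (Y - m * r ^ 2))
      = (1 - μ) ^ 2 * (X - m * t ^ 2) - 2 * (1 - μ) * (Z - m * (t * r))
      + ((1 - μ) * (m + 1 - μ)) * (Y - m * r ^ 2) := by ring
  rw [this, h2]
  linarith

/-- Bound on the averages. -/
lemma avg_lower (m l a b c d : ℝ) (h1 : 0 < 1 - l)
    (h2 : (1 - l) * (2 * m + 1 - l) = 1) (hs : a + b + c + d = 0) :
    l * (a ^ 2 + b ^ 2 + c ^ 2 + d ^ 2) ≤ a ^ 2 - 2 * a * b + (m + 1) * b ^ 2 - 2 * m * b * c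
      + (m + 1) * c ^ 2 - 2 * c * d + d ^ 2 := by
  have hd : d = -a - b - c := by linarith
  have k1 : 0 ≤ (1 - l) * ((a - d) ^ 2) - 2 * (a - d) * (b - c)
      + (2 * m + 1 - l) * (b - c) ^ 2 := by
    refine nonneg_of_mul_nonneg_right (a := 1 - l) ?_ h1
    have : (1 - l) * ((1 - l) * ((a - d) ^ 2) - 2 * (a - d) * (b - c)
      + (2 * m + 1 - l) * (b - c) ^ 2) = ((1 - l) * (a - d) - (b - c)) ^ 2
      + ((1 - l) * (2 * m + 1 - l) - 1) * (b - c) ^ 2 := by ring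
    rw [this, h2]
    nlinarith [sq_nonneg ((1 - l) * (a - d) - (b - c))]
  have k2 : 0 ≤ (2 - l) * (b + c) ^ 2 := by
    have : 0 ≤ 2 - l := by linarith
    positivity
  subst hd
  nlinarith

lemma lam_facts (m : ℕ) (hm : 1 ≤ m) : 0 < lamMinus m ∧ 0 < 1 - lamMinus m ∧
    (1 - lamMinus m) * (2 * m + 1 - lamMinus m) = 1 ∧ 0 < 1 - muMinus m ∧
    (1 - muMinus m) * (m + 1 - muMinus m) = 1 ∧ 0 < lamMinus m - muMinus m := by
  have hm' : (1 : ℝ) ≤ m := by exact_mod_cast hm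
  unfold lamMinus muMinus
  have ha := Real.sq_sqrt (show (0 : ℝ) ≤ (m : ℝ) ^ 2 + 1 by positivity)
  have hb := Real.sq_sqrt (show (0 : ℝ) ≤ (m : ℝ) ^ 2 / 4 + 1 by positivity)
  have ha0 := Real.sqrt_nonneg ((m : ℝ) ^ 2 + 1)
  have hb0 := Real.sqrt_nonneg ((m : ℝ) ^ 2 / 4 + 1)
  generalize Real.sqrt ((m : ℝ) ^ 2 + 1) = A at *
  generalize Real.sqrt ((m : ℝ) ^ 2 / 4 + 1) = B at *
  generalize (m : ℝ) = M at *
  have hA : M < A := by nlinarith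
  have hB : M / 2 < B := by nlinarith
  have hA1 : A < M + 1 := by nlinarith
  refine ⟨by linarith, by linarith, by nlinarith, by linarith, by nlinarith, ?_⟩
  nlinarith

/-- Let `G₁, G₂, G₃, G₄` be simple connected graphs on `m` vertices with Laplacians
`L₁, …, L₄`, let `L₀ = diag(L₁, L₂, L₃, L₄)` and `L = L₀ + L_*`, and assume
`a(Gₖ) ≥ λ₋ - μ₋` for `k = 1, 2, 3, 4`.  Then the second-smallest eigenvalue of `L` equals
`λ₋ = m + 1 - √(m² + 1)` with eigenvector `φ₋ = (1, 1-λ₋, λ₋-1, -1)ᵀ ⊗ 𝟙`;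
that is, `L φ₋ = λ₋ φ₋` and `⟨L v, v⟩ ≥ λ₋ ⟨v, v⟩` for every `v ⊥ 𝟙_{4m}`. -/
theorem stmt8 (m : ℕ) (hm : 1 ≤ m) (G : Fin 4 → SimpleGraph (Fin m))
    [∀ k, DecidableRel (G k).Adj] (hconn : ∀ k, (G k).Connected)
    (ha : ∀ k, algConn (G k) ≥ lamMinus m - muMinus m)
    (L : Matrix (Fin 4 × Fin m) (Fin 4 × Fin m) ℝ)
    (hL : L = blockDiag4 (fun k => SimpleGraph.lapMatrix ℝ (G k)) + Lstar m) :
    secondEig L = lamMinus m ∧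
    L.mulVec (tensor ![1, 1 - lamMinus m, lamMinus m - 1, -1] (fun _ => 1)) = lamMinus m • (tensor ![1, 1 - lamMinus m, lamMinus m - 1, -1] (fun _ => 1)) ∧
    ∀ v : Fin 4 × Fin m → ℝ, (∑ i, v i) = 0 →
      L.mulVec v ⬝ᵥ v ≥ lamMinus m * (v ⬝ᵥ v) := by
  obtain ⟨f1, f2, f3, f4, f5, f6⟩ := lam_facts m hm
  have hm0 : (m : ℝ) ≠ 0 := by positivity
  have hm1 : (0 : ℝ) < m := by positivity
  have hH : L.IsHermitian := by
    rw [hL]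
    exact (blockDiag4_symm _ fun k => SimpleGraph.isHermitian_lapMatrix ℝ (G k)).add (Lstar_symm m)
  have hconst : ∀ (k : Fin 4) (c : ℝ),
      SimpleGraph.lapMatrix ℝ (G k) *ᵥ (fun _ => c) = 0 := by
    intro k c
    have h : (fun _ : Fin m => c) = c • (fun _ => (1 : ℝ)) := by
      ext
      simp
    rw [h, mulVec_smul, SimpleGraph.lapMatrix_mulVec_const_eq_zero, smul_zero]
  have hphi : L.mulVec (tensor ![1, 1 - lamMinus m, lamMinus m - 1, -1] (fun _ => 1)) =
      lamMinus m • (tensor ![1, 1 - lamMinus m, lamMinus m - 1, -1] (fun _ => 1)) := by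
    rw [hL, add_mulVec]
    ext ⟨k, p⟩
    rw [Pi.add_apply, blockDiag4_mulVec]
    simp only [tensor, hconst]
    fin_cases k
    · simp [Lstar_mulVec0, tensor]
    · simp [Lstar_mulVec1, tensor]
      linarith
    · simp [Lstar_mulVec2, tensor]
      linarith
    · simp [Lstar_mulVec3, tensor]
      ring
  have hone : L *ᵥ (fun _ => 1) = 0 := by
    rw [hL, add_mulVec]
    ext ⟨k, p⟩
    rw [Pi.add_apply, blockDiag4_mulVec]
    simp only [hconst]
    fin_cases k
    · simp [Lstar_mulVec0]
    · simp [Lstar_mulVec1]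
    · simp [Lstar_mulVec2]
    · simp [Lstar_mulVec3]
  have hform : ∀ v : Fin 4 × Fin m → ℝ, (∑ i, v i) = 0 →
      L.mulVec v ⬝ᵥ v ≥ lamMinus m * (v ⬝ᵥ v) := by
    intro v hv
    have g := fun k => lap_lower hm (G k) _ f6 (ha k) (fun q => v (k, q))
    have g0 := g 0
    have g1 := g 1
    have g2 := g 2
    have g3 := g 3
    have p1 := pair_lower hm (muMinus m) f4 f5 (fun q => v (0, q)) (fun q => v (1, q))
    have p2 := pair_lower hm (muMinus m) f4 f5 (fun q => v (3, q)) (fun q => v (2, q))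
    rw [Fintype.sum_prod_type, Fin.sum_univ_four] at hv
    have av := avg_lower m (lamMinus m) _ _ _ _ f2 f3 hv
    have av2 := div_le_div_of_nonneg_right av hm1.le
    have x0 : ∀ p, (v (0, p) - v (1, p)) * v (0, p)
        = v (0, p) * v (0, p) - v (0, p) * v (1, p) := fun p => by ring
    have x1 : ∀ p, (- v (0, p) + (m + 1) * v (1, p) - ∑ q, v (2, q)) * v (1, p)
        = (m + 1) * (v (1, p) * v (1, p)) - v (0, p) * v (1, p)
          - (∑ q, v (2, q)) * v (1, p) := fun p => by ring
    have x2 : ∀ p, (- v (3, p) + (m + 1) * v (2, p) - ∑ q, v (1, q)) * v (2, p)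
        = (m + 1) * (v (2, p) * v (2, p)) - v (3, p) * v (2, p)
          - (∑ q, v (1, q)) * v (2, p) := fun p => by ring
    have x3 : ∀ p, (v (3, p) - v (2, p)) * v (3, p)
        = v (3, p) * v (3, p) - v (3, p) * v (2, p) := fun p => by ring
    rw [hL, add_mulVec, add_dotProduct]
    simp only [dotProduct, Fintype.sum_prod_type, Fin.sum_univ_four, blockDiag4_mulVec,
      Lstar_mulVec0, Lstar_mulVec1, Lstar_mulVec2, Lstar_mulVec3, x0, x1, x2, x3,
      Finset.sum_sub_distrib, ← Finset.mul_sum]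
    clear x0 x1 x2 x3 g av hphi hone hconst hH
    generalize (∑ p, (SimpleGraph.lapMatrix ℝ (G 0) *ᵥ fun q => v (0, q)) p * v (0, p)) = A0 at *
    generalize (∑ p, (SimpleGraph.lapMatrix ℝ (G 1) *ᵥ fun q => v (1, q)) p * v (1, p)) = A1 at *
    generalize (∑ p, (SimpleGraph.lapMatrix ℝ (G 2) *ᵥ fun q => v (2, q)) p * v (2, p)) = A2 at *
    generalize (∑ p, (SimpleGraph.lapMatrix ℝ (G 3) *ᵥ fun q => v (3, q)) p * v (3, p)) = A3 at *
    generalize (∑ p, v (0, p) * v (0, p)) = Q0 at *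
    generalize (∑ p, v (1, p) * v (1, p)) = Q1 at *
    generalize (∑ p, v (2, p) * v (2, p)) = Q2 at *
    generalize (∑ p, v (3, p) * v (3, p)) = Q3 at *
    generalize (∑ p, v (0, p) * v (1, p)) = C1 at *
    generalize (∑ p, v (3, p) * v (2, p)) = C2 at *
    generalize (∑ p, v (0, p)) = S0 at *
    generalize (∑ p, v (1, p)) = S1 at *
    generalize (∑ p, v (2, p)) = S2 at *
    generalize (∑ p, v (3, p)) = S3 at *
    have total := add_le_add (add_le_add (add_le_add (add_le_add g0 g1) (add_le_add g2 g3))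
      (add_le_add p1 p2)) av2
    rw [ge_iff_le, ← sub_nonneg]
    rw [← sub_nonneg] at total
    refine total.trans_eq ?_
    field_simp
    ring
  refine ⟨?_, hphi, hform⟩
  refine secondEig_of_form L hH (fun _ => 1) _ _ f1 hone ?_ hphi ?_ ?_
  · simp [dotProduct, hm0]
  · simp only [dotProduct, tensor, Fintype.sum_prod_type, Fin.sum_univ_four]
    simp
    have h := mul_nonneg hm1.le (mul_self_nonneg (1 - lamMinus m))
    have h' := mul_nonneg hm1.le (mul_self_nonneg (lamMinus m - 1))
    apply ne_of_gt
    linarith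
  · intro v hv
    exact hform v (by simpa [dotProduct] using hv)
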